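/- For every set Σ of quasi-identities of type τ and every quasi-identity e of type τ: e is derivable from Σ in the calculus HQ if and only if e is derivable from (7.4)(Σ) in the calculus Q. In symbols: Σ ⊢_HQ e if and only if (7.4)(Σ) ⊢_Q e. -/

import Mathlib

open scoped Classical

/-- Terms of a type `τ = (I, ar)`: an indexed family of operation symbols `I`
with arities `ar`, over countably many variables. -/
inductive Trm (I : Type) (ar : I → ℕ) : Type
  | var : ℕ → Trm I ar
  | app (f : I) : (Fin (ar f) → Trm I ar) → Trm I ar

variable {I : Type} {ar : I → ℕ}

/-- Simultaneous substitution of terms for variables. -/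
def Trm.subst (δ : ℕ → Trm I ar) : Trm I ar → Trm I ar
  | .var n => δ n
  | .app f ts => .app f fun i => (ts i).subst δ

/-- A hypersubstitution assigns to each operation symbol `f` a term `σ(f)`. -/
def Hyp (I : Type) (ar : I → ℕ) := (f : I) → Trm I ar

/-- The extension of a hypersubstitution to all terms. -/
def Hyp.apply (σ : Hyp I ar) : Trm I ar → Trm I ar
  | .var n => .var n
  | .app f ts => (σ f).subst fun n => if h : n < ar f then σ.apply (ts ⟨n, h⟩) else .var n

/-- The identity hypersubstitution `σ_id`. -/
def Hyp.id (I : Type) (ar : I → ℕ) : Hyp I ar := fun f => .app f fun i => .var i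

/-- Composition of hypersubstitutions: `(σ₁ ∘ σ₂)(f) = σ₁(σ₂(f))`. -/
def Hyp.comp (σ₁ σ₂ : Hyp I ar) : Hyp I ar := fun f => σ₁.apply (σ₂ f)

/-- Occurrence of the variable `m` in a term. -/
inductive Occurs (m : ℕ) : Trm I ar → Prop
  | var : Occurs m (.var m)
  | app {f ts} (i : Fin (ar f)) : Occurs m (ts i) → Occurs m (.app f ts)

/-- `σ` is a genuine hypersubstitution: `σ(f)` is an `(ar f)`-ary term,
i.e. its variables are among `x₀, …, x_{ar f - 1}`.  The set `{σ | IsHyp σ}`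
plays the role of the monoid `H(τ)` of all hypersubstitutions of type `τ`. -/
def IsHyp (σ : Hyp I ar) : Prop := ∀ f m, Occurs m (σ f) → m < ar f

/-- An identity `t ≈ s` of type `τ`. -/
abbrev Eqn (I : Type) (ar : I → ℕ) := Trm I ar × Trm I ar

/-- A quasi-identity `Δ → α` of type `τ`: a finite set `Δ` of identities
(the premises) together with an identity `α` (the conclusion). -/
abbrev Quasi (I : Type) (ar : I → ℕ) := Finset (Eqn I ar) × Eqn I ar

/-- Applying a map on terms to every term occurring in a quasi-identity. -/
noncomputable def mapQ (g : Trm I ar → Trm I ar) (q : Quasi I ar) : Quasi I ar :=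
  (q.1.image fun p => (g p.1, g p.2), (g q.2.1, g q.2.2))

/-- An algebra of type `τ`. -/
structure Alg (I : Type) (ar : I → ℕ) where
  carrier : Type
  ops : (f : I) → (Fin (ar f) → carrier) → carrier

/-- Evaluation of a term in an algebra under an assignment `v`. -/
def Alg.eval (A : Alg I ar) (v : ℕ → A.carrier) : Trm I ar → A.carrier
  | .var n => v n
  | .app f ts => A.ops f fun i => A.eval v (ts i)

/-- Satisfaction of a quasi-identity in an algebra: every assignment making all
premises hold makes the conclusion hold. -/
def Alg.Sat (A : Alg I ar) (q : Quasi I ar) : Prop :=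
  ∀ v : ℕ → A.carrier,
    (∀ p ∈ q.1, A.eval v p.1 = A.eval v p.2) → A.eval v q.2.1 = A.eval v q.2.2

/-- `M`-hypersatisfaction of a quasi-identity in an algebra: `A` satisfies
`σ(q)` for every hypersubstitution `σ ∈ M`. -/
def Alg.HypSatM (A : Alg I ar) (M : Set (Hyp I ar)) (q : Quasi I ar) : Prop :=
  ∀ σ ∈ M, A.Sat (mapQ (Hyp.apply σ) q)

/-- The quasi-equational calculus `Q` (when `M = ∅`), resp. its extension by the
hypersubstitution rule for the hypersubstitutions of `M`: `MHQ` for a submonoid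
`M ⊆ H(τ)`, and `HQ` when `M = {σ | IsHyp σ} = H(τ)`. -/
inductive Der (M : Set (Hyp I ar)) (S : Set (Quasi I ar)) : Quasi I ar → Prop
  | hyp {q} : q ∈ S → Der M S q
  | refl (p : Trm I ar) : Der M S (∅, (p, p))
  | assm (α : Eqn I ar) : Der M S ({α}, α)
  | symm (p q : Trm I ar) : Der M S ({(p, q)}, (q, p))
  | trans (p q r : Trm I ar) : Der M S ({(p, q), (q, r)}, (p, r))
  | compat (f : I) (t s : Fin (ar f) → Trm I ar) :
      Der M S (Finset.univ.image fun i => (t i, s i), (.app f t, .app f s))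
  | subst {q} (δ : ℕ → Trm I ar) : Der M S q → Der M S (mapQ (Trm.subst δ) q)
  | hypsub {q} {σ : Hyp I ar} : σ ∈ M → Der M S q → Der M S (mapQ (Hyp.apply σ) q)
  | cut {Δ Γ : Finset (Eqn I ar)} {α β : Eqn I ar} :
      Der M S (Δ, α) → Der M S (insert α Γ, β) → Der M S (Δ ∪ Γ, β)
  | ext {Δ : Finset (Eqn I ar)} {α : Eqn I ar} (β : Eqn I ar) :
      Der M S (Δ, α) → Der M S (insert β Δ, α)

theorem mapQ_congr {g h : Trm I ar → Trm I ar} (H : ∀ t, g t = h t) (q : Quasi I ar) :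
    mapQ g q = mapQ h q := by
  rw [funext H]

theorem mapQ_mapQ (g h : Trm I ar → Trm I ar) (q : Quasi I ar) :
    mapQ g (mapQ h q) = mapQ (fun t => g (h t)) q := by
  simp [mapQ, Finset.image_image, Function.comp_def]

theorem mapQ_self (q : Quasi I ar) : mapQ (fun t => t) q = q := by
  simp [mapQ]

/-- Substitution depends only on the variables occurring in the term. -/
theorem Trm.subst_congr {δ δ' : ℕ → Trm I ar} (t : Trm I ar)
    (h : ∀ m, Occurs m t → δ m = δ' m) : t.subst δ = t.subst δ' := by
  induction t with
  | var n => exact h n .var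
  | app f ts ih =>
    simp only [Trm.subst]
    congr 1
    funext i
    exact ih i fun m hm => h m (.app i hm)

theorem Trm.subst_subst (δ ε : ℕ → Trm I ar) (t : Trm I ar) :
    (t.subst δ).subst ε = t.subst fun n => (δ n).subst ε := by
  induction t with
  | var n => rfl
  | app f ts ih => simp [Trm.subst, ih]

theorem Occurs.of_subst {δ : ℕ → Trm I ar} {m : ℕ} (t : Trm I ar)
    (h : Occurs m (t.subst δ)) : ∃ n, Occurs n t ∧ Occurs m (δ n) := by
  induction t with
  | var n => exact ⟨n, .var, h⟩
  | app f ts ih =>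
    cases h with
    | app i hi =>
      obtain ⟨n, hn, hm⟩ := ih i hi
      exact ⟨n, .app i hn, hm⟩

/-- Hypersubstitutions introduce no new variables. -/
theorem IsHyp.occurs_of_apply {σ : Hyp I ar} (hσ : IsHyp σ) {m : ℕ} (t : Trm I ar)
    (h : Occurs m (σ.apply t)) : Occurs m t := by
  induction t with
  | var n => exact h
  | app f ts ih =>
    rw [Hyp.apply] at h
    obtain ⟨n, hn, hm⟩ := Occurs.of_subst _ h
    rw [dif_pos (hσ f n hn)] at hm
    exact .app _ (ih _ hm)

theorem IsHyp.apply_subst {σ : Hyp I ar} (hσ : IsHyp σ) (δ : ℕ → Trm I ar) (t : Trm I ar) :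
    σ.apply (t.subst δ) = (σ.apply t).subst fun n => σ.apply (δ n) := by
  induction t with
  | var n => rfl
  | app f ts ih =>
    simp only [Trm.subst, Hyp.apply, Trm.subst_subst]
    refine Trm.subst_congr _ fun m hm => ?_
    simp [hσ f m hm, ih]

theorem isHyp_id : IsHyp (Hyp.id I ar) := by
  intro f m h
  cases h with
  | app i hi =>
    cases hi
    exact i.2

theorem Hyp.apply_id (t : Trm I ar) : (Hyp.id I ar).apply t = t := by
  induction t with
  | var n => rfl
  | app f ts ih =>
    rw [Hyp.apply]
    simp only [ih]
    simp [Hyp.id, Trm.subst]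

theorem IsHyp.comp {σ ρ : Hyp I ar} (hσ : IsHyp σ) (hρ : IsHyp ρ) : IsHyp (σ.comp ρ) :=
  fun f m h => hρ f m (hσ.occurs_of_apply _ h)

theorem IsHyp.apply_comp {σ ρ : Hyp I ar} (hσ : IsHyp σ) (hρ : IsHyp ρ) (t : Trm I ar) :
    (σ.comp ρ).apply t = σ.apply (ρ.apply t) := by
  induction t with
  | var n => rfl
  | app f ts ih =>
    simp only [Hyp.apply, hσ.apply_subst]
    refine Trm.subst_congr _ fun m hm => ?_
    simp [hσ.comp hρ f m hm, ih]

section Calculus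

variable {M : Set (Hyp I ar)} {S : Set (Quasi I ar)}

theorem Der.weaken {Δ : Finset (Eqn I ar)} {α : Eqn I ar} (Γ : Finset (Eqn I ar))
    (h : Der M S (Δ, α)) : Der M S (Γ ∪ Δ, α) := by
  induction Γ using Finset.induction_on with
  | empty => simpa using h
  | insert β Γ _ ih =>
    rw [Finset.insert_union]
    exact ih.ext β

theorem Der.of_mem {Γ : Finset (Eqn I ar)} {α : Eqn I ar} (h : α ∈ Γ) : Der M S (Γ, α) := by
  have := Der.weaken Γ (Der.assm (M := M) (S := S) α)
  rwa [Finset.union_eq_left.2 (Finset.singleton_subset_iff.2 h)] at this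

theorem Der.cut_union {Γ : Finset (Eqn I ar)} {α : Eqn I ar} (Δ : Finset (Eqn I ar))
    (hΔ : ∀ β ∈ Δ, Der M S (Γ, β)) (h : Der M S (Δ ∪ Γ, α)) : Der M S (Γ, α) := by
  induction Δ using Finset.induction_on with
  | empty => simpa using h
  | insert β Δ _ ih =>
    refine ih (fun γ hγ => hΔ γ (Finset.mem_insert_of_mem hγ)) ?_
    rw [Finset.insert_union] at h
    have := (hΔ β (Finset.mem_insert_self _ _)).cut h
    rwa [Finset.union_left_comm, Finset.union_self] at this

/-- Simultaneous cut of all premises. -/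
theorem Der.cut_all {Γ Δ : Finset (Eqn I ar)} {α : Eqn I ar}
    (hΔ : ∀ β ∈ Δ, Der M S (Γ, β)) (h : Der M S (Δ, α)) : Der M S (Γ, α) := by
  refine Der.cut_union Δ hΔ ?_
  rw [Finset.union_comm]
  exact h.weaken Γ

/-- The compatibility axiom extended from operation symbols to arbitrary terms. -/
theorem Der.subst_compat {Γ : Finset (Eqn I ar)} {δ δ' : ℕ → Trm I ar} (t : Trm I ar)
    (h : ∀ m, Occurs m t → Der M S (Γ, (δ m, δ' m))) :
    Der M S (Γ, (t.subst δ, t.subst δ')) := by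
  induction t with
  | var n => exact h n .var
  | app f ts ih =>
    refine Der.cut_all ?_ (Der.compat f _ _)
    intro β hβ
    obtain ⟨i, -, rfl⟩ := Finset.mem_image.1 hβ
    exact ih i fun m hm => h m (.app i hm)

/-- Over a set of quasi-identities closed under `σ`, the hypersubstitution rule
for `σ` is admissible in the calculus `Q`. -/
theorem Der.mapQ_apply {σ : Hyp I ar} (hσ : IsHyp σ)
    (hS : ∀ q ∈ S, mapQ (Hyp.apply σ) q ∈ S) {q : Quasi I ar} (h : Der ∅ S q) :
    Der ∅ S (mapQ (Hyp.apply σ) q) := by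
  induction h with
  | hyp hq => exact .hyp (hS _ hq)
  | refl p => simpa [mapQ] using Der.refl _
  | assm α => simpa [mapQ] using Der.assm _
  | symm p q => simpa [mapQ] using Der.symm _ _
  | trans p q r => simpa [mapQ, Finset.image_insert] using Der.trans _ _ _
  | compat f t s =>
    simp only [mapQ, Finset.image_image, Hyp.apply]
    refine Der.subst_compat _ fun m hm => ?_
    have hm' := hσ f m hm
    simp only [dif_pos hm']
    exact Der.of_mem (Finset.mem_image.2 ⟨⟨m, hm'⟩, Finset.mem_univ _, rfl⟩)
  | subst δ _ ih =>
    have := ih.subst fun n => σ.apply (δ n)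
    rw [mapQ_mapQ] at this ⊢
    rwa [mapQ_congr (hσ.apply_subst δ)]
  | hypsub hM => exact hM.elim
  | cut _ _ ih₁ ih₂ =>
    simp only [mapQ, Finset.image_insert, Finset.image_union] at ih₁ ih₂ ⊢
    exact ih₁.cut ih₂
  | ext β _ ih =>
    simp only [mapQ, Finset.image_insert] at ih ⊢
    exact ih.ext _

end Calculus

/-- A derivation from `Σ` in `HQ` is the same as a derivation in `Q` from
`(7.4)(Σ) = {σ(e) : e ∈ Σ, σ ∈ H(τ)}`:  `Σ ⊢_HQ e ↔ (7.4)(Σ) ⊢_Q e`. -/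
theorem derHQ_iff_derQ_closure (S : Set (Quasi I ar)) (e : Quasi I ar) :
    Der {σ : Hyp I ar | IsHyp σ} S e ↔
      Der ∅ {q' : Quasi I ar | ∃ q ∈ S, ∃ σ : Hyp I ar, IsHyp σ ∧ q' = mapQ (Hyp.apply σ) q} e := by
  constructor
  · intro h
    induction h with
    | @hyp q hq =>
      refine .hyp ⟨q, hq, Hyp.id I ar, isHyp_id, ?_⟩
      rw [mapQ_congr Hyp.apply_id, mapQ_self]
    | refl p => exact .refl p
    | assm α => exact .assm α
    | symm p q => exact .symm p q
    | trans p q r => exact .trans p q r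
    | compat f t s => exact .compat f t s
    | subst δ _ ih => exact ih.subst δ
    | @hypsub _ σ hσ _ ih =>
      refine ih.mapQ_apply hσ ?_
      rintro _ ⟨q, hq, ρ, hρ, rfl⟩
      refine ⟨q, hq, σ.comp ρ, IsHyp.comp hσ hρ, ?_⟩
      rw [mapQ_mapQ, mapQ_congr (IsHyp.apply_comp hσ hρ)]
    | cut _ _ ih₁ ih₂ => exact ih₁.cut ih₂
    | ext β _ ih => exact ih.ext β
  · intro h
    induction h with
    | hyp hq =>
      obtain ⟨q, hq, σ, hσ, rfl⟩ := hq
      exact .hypsub hσ (.hyp hq)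
    | refl p => exact .refl p
    | assm α => exact .assm α
    | symm p q => exact .symm p q
    | trans p q r => exact .trans p q r
    | compat f t s => exact .compat f t s
    | subst δ _ ih => exact ih.subst δ
    | hypsub hM => exact hM.elim
    | cut _ _ ih₁ ih₂ => exact ih₁.cut ih₂
    | ext β _ ih => exact ih.ext β
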